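/- Let k ≥ 1 be an integer and let a₁, …, a_k : ℤ → ℝ_{≥0} be rapidly decreasing sequences, i.e. for every r ∈ ℕ there is a constant C_r > 0 such that a_j(i) ≤ C_r·(1+|i|)^{−r} for all 1 ≤ j ≤ k and all i ∈ ℤ. Then there exists a constant C > 0 such that for every natural number n, the (convergent) sum over all (i₁, …, i_k) ∈ ℤ^k with i₁ + ⋯ + i_k = 0 of ∏_{j=1}^k (|i_j| + |n − (i₁ + ⋯ + i_j)|)·a_j(i_j) is at most C·(1+n)^k; that is, the sum grows at most polynomially of degree k in n. -/

import Mathlib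

open Finset

lemma aux_summable_one : Summable fun i : ℤ => 1 / (1 + |(i : ℝ)|) ^ 2 := by
  have h : Summable fun n : ℕ => 1 / (1 + (n : ℝ)) ^ 2 := by
    have := (summable_nat_add_iff 1).2 (Real.summable_one_div_nat_pow.2 (by norm_num : 1 < 2))
    refine this.congr fun n => ?_
    push_cast
    rw [add_comm]
  apply Summable.of_nat_of_neg
  · simpa using h
  · simpa using h

lemma aux_summable_pi (g : ℤ → ℝ) (hg0 : ∀ i, 0 ≤ g i) (hg : Summable g) (k : ℕ) :
    Summable fun v : Fin k → ℤ => ∏ j, g (v j) := by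
  induction k with
  | zero => exact Summable.of_finite
  | succ k ih =>
    rw [← (Fin.consEquiv fun _ : Fin (k + 1) => ℤ).summable_iff]
    have := hg.mul_of_nonneg ih hg0 (fun v => Finset.prod_nonneg fun j _ => hg0 _)
    refine this.congr fun p => ?_
    simp [Fin.consEquiv, Fin.prod_univ_succ]

lemma aux_sum_le_prod {ι : Type*} (s : Finset ι) (x : ι → ℝ) (hx : ∀ i, 0 ≤ x i) :
    1 + ∑ i ∈ s, x i ≤ ∏ i ∈ s, (1 + x i) := by
  classical
  induction s using Finset.induction_on with
  | empty => simp
  | insert i s hi ih =>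
    rw [Finset.sum_insert hi, Finset.prod_insert hi]
    have h1 : 0 ≤ ∑ i ∈ s, x i := Finset.sum_nonneg fun i _ => hx i
    nlinarith [hx i, mul_nonneg (hx i) h1, mul_le_mul_of_nonneg_left ih (hx i)]

lemma aux_factor (k n : ℕ) (v : Fin k → ℤ) (j : Fin k) :
    ((|v j| + |(n : ℤ) - ∑ l ∈ Finset.Iic j, v l| : ℤ) : ℝ) ≤
      2 * (1 + (n : ℝ)) * ∏ l, (1 + |(v l : ℝ)|) := by
  have h1 := aux_sum_le_prod Finset.univ (fun l => |(v l : ℝ)|) (fun _ => abs_nonneg _)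
  have h2 : |(v j : ℝ)| ≤ ∑ l, |(v l : ℝ)| :=
    Finset.single_le_sum (f := fun l => |(v l : ℝ)|) (fun _ _ => abs_nonneg _) (Finset.mem_univ j)
  have h3 : |∑ l ∈ Finset.Iic j, (v l : ℝ)| ≤ ∑ l, |(v l : ℝ)| :=
    (Finset.abs_sum_le_sum_abs _ _).trans
      (Finset.sum_le_sum_of_subset_of_nonneg (Finset.subset_univ _) fun _ _ _ => abs_nonneg _)
  have h4 : |(n : ℝ) - ∑ l ∈ Finset.Iic j, (v l : ℝ)| ≤ n + |∑ l ∈ Finset.Iic j, (v l : ℝ)| := by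
    simpa using abs_sub (n : ℝ) (∑ l ∈ Finset.Iic j, (v l : ℝ))
  have hS : 0 ≤ ∑ l, |(v l : ℝ)| := Finset.sum_nonneg fun _ _ => abs_nonneg _
  have hn : (0 : ℝ) ≤ n := Nat.cast_nonneg n
  push_cast
  have h5 := mul_le_mul_of_nonneg_left h1 (by positivity : 0 ≤ 2 * (1 + (n : ℝ)))
  nlinarith [mul_nonneg hn hS]


/-- Combinatorial energy estimate: if `a₁, …, a_k : ℤ → ℝ≥0` are rapidly decreasing
sequences, then there is a constant `C > 0` such that for every `n : ℕ` the sum over all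
`(i₁, …, i_k) ∈ ℤᵏ` with `i₁ + ⋯ + i_k = 0` of
`∏_{j=1}^k (|i_j| + |n − (i₁ + ⋯ + i_j)|)·a_j(i_j)` converges and is at most
`C·(1+n)ᵏ`. -/
theorem energy_estimate_polynomial_growth
    (k : ℕ) (hk : 1 ≤ k) (a : Fin k → ℤ → ℝ)
    (ha_nonneg : ∀ j i, 0 ≤ a j i)
    (ha_decay : ∀ r : ℕ, ∃ C : ℝ, 0 < C ∧ ∀ j i, a j i ≤ C / (1 + |(i : ℝ)|) ^ r) :
    ∃ C : ℝ, 0 < C ∧ ∀ n : ℕ,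
      (Summable fun v : {v : Fin k → ℤ // ∑ j, v j = 0} =>
        ∏ j : Fin k,
          ((|v.1 j| + |(n : ℤ) - ∑ l ∈ Finset.Iic j, v.1 l| : ℤ) : ℝ) * a j (v.1 j)) ∧
      (∑' v : {v : Fin k → ℤ // ∑ j, v j = 0},
          ∏ j : Fin k,
            ((|v.1 j| + |(n : ℤ) - ∑ l ∈ Finset.Iic j, v.1 l| : ℤ) : ℝ) * a j (v.1 j))
        ≤ C * (1 + (n : ℝ)) ^ k := by
  obtain ⟨C, hC, hdec⟩ := ha_decay (k + 2)
  set g : ℤ → ℝ := fun i => 1 / (1 + |(i : ℝ)|) ^ 2 with hg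
  have hg0 : ∀ i, 0 ≤ g i := fun i => by positivity
  have hsum := aux_summable_pi g hg0 aux_summable_one k
  have hsub : Summable fun v : {v : Fin k → ℤ // ∑ j, v j = 0} => ∏ j, g (v.1 j) :=
    hsum.subtype {v : Fin k → ℤ | ∑ j, v j = 0}
  set T := ∑' v : {v : Fin k → ℤ // ∑ j, v j = 0}, ∏ j, g (v.1 j) with hT
  have hT0 : 0 ≤ T := tsum_nonneg fun v => Finset.prod_nonneg fun j _ => hg0 _
  refine ⟨(2 * C) ^ k * (T + 1), by positivity, fun n => ?_⟩
  have hn : (0 : ℝ) ≤ n := Nat.cast_nonneg n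
  have hf0 : ∀ (v : Fin k → ℤ) (j : Fin k),
      (0 : ℝ) ≤ ((|v j| + |(n : ℤ) - ∑ l ∈ Finset.Iic j, v l| : ℤ) : ℝ) := fun v j => by
    have : (0 : ℤ) ≤ |v j| + |(n : ℤ) - ∑ l ∈ Finset.Iic j, v l| := by positivity
    exact_mod_cast this
  have hle : ∀ v : {v : Fin k → ℤ // ∑ j, v j = 0},
      ∏ j : Fin k,
          ((|v.1 j| + |(n : ℤ) - ∑ l ∈ Finset.Iic j, v.1 l| : ℤ) : ℝ) * a j (v.1 j)
      ≤ ((2 * C) ^ k * (1 + (n : ℝ)) ^ k) * ∏ j, g (v.1 j) := by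
    intro v
    calc _ ≤ ∏ j : Fin k, (2 * (1 + (n : ℝ)) * ∏ l, (1 + |(v.1 l : ℝ)|)) *
            (C / (1 + |(v.1 j : ℝ)|) ^ (k + 2)) := by
          refine Finset.prod_le_prod (fun j _ => mul_nonneg (hf0 _ _) (ha_nonneg _ _)) fun j _ => ?_
          exact mul_le_mul (aux_factor k n v.1 j) (hdec _ _) (ha_nonneg _ _) (by positivity)
      _ = ((2 * C) ^ k * (1 + (n : ℝ)) ^ k) *
            ((∏ l, (1 + |(v.1 l : ℝ)|)) ^ k * ∏ j, (1 / (1 + |(v.1 j : ℝ)|) ^ (k + 2))) := by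
          simp only [div_eq_mul_inv, one_mul, Finset.prod_mul_distrib, Finset.prod_const,
            Finset.card_univ, Fintype.card_fin, mul_pow]
          ring
      _ = _ := by
          congr 1
          rw [← Finset.prod_pow, ← Finset.prod_mul_distrib]
          refine Finset.prod_congr rfl fun j _ => ?_
          have : (1 + |(v.1 j : ℝ)|) ≠ 0 := by positivity
          simp only [hg]
          field_simp
          ring
  have hs := Summable.of_nonneg_of_le
    (fun v : {v : Fin k → ℤ // ∑ j, v j = 0} =>
      Finset.prod_nonneg fun j _ => mul_nonneg (hf0 v.1 j) (ha_nonneg j (v.1 j)))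
    hle (hsub.mul_left _)
  refine ⟨hs, (hs.tsum_le_tsum hle (hsub.mul_left _)).trans ?_⟩
  rw [tsum_mul_left, ← hT]
  have : 0 ≤ (2 * C) ^ k * (1 + (n : ℝ)) ^ k := by positivity
  nlinarith
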